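/- Let r = X → Y be a totally-ordered sequential rule over a sequence database D, and let r' be a ToSR obtained from r by a right I-expansion or a right S-expansion with an item i. Then u(r') ≤ REPEU(r). -/

import Mathlib

open scoped Classical

noncomputable section

namespace TotalSR

variable {I : Type*} [LinearOrder I]

/-- A sequence: a list of itemsets. -/
abbrev Seqc (I : Type*) := List (Finset I)

/-- The set of items occurring in a sequence. -/
def itemsOf (s : Seqc I) : Finset I := s.foldr (· ∪ ·) ∅

/-- Well-formed sequence: nonempty, all itemsets nonempty, and each item
occurs at most once (itemsets pairwise disjoint). -/
def WFSeq (s : Seqc I) : Prop :=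
  s ≠ [] ∧ (∀ e ∈ s, e.Nonempty) ∧ s.Pairwise fun a b => Disjoint a b

/-- `s₁` occurs in `s₂` (written s₁ ⊑ s₂): there exist strictly increasing
indices matching each itemset of `s₁` into a superset itemset of `s₂`. -/
def OccursIn (s₁ s₂ : Seqc I) : Prop :=
  ∃ t : List (Finset I), t.Sublist s₂ ∧ List.Forall₂ (· ⊆ ·) s₁ t

/-- The rule X → Y occurs in s: there is a split position 1 ≤ k < |s|
with X occurring in the first k itemsets and Y in the remaining ones. -/
def RuleOccursIn (X Y s : Seqc I) : Prop :=
  ∃ k, 1 ≤ k ∧ k < s.length ∧ OccursIn X (s.take k) ∧ OccursIn Y (s.drop k)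

/-- seq(r): the sequences of the database D in which the rule X → Y occurs. -/
def seqL (D : List (Seqc I)) (X Y : Seqc I) : List (Seqc I) :=
  D.filter fun s => decide (RuleOccursIn X Y s)

/-- ant(r): the sequences of the database D in which the antecedent X occurs. -/
def antL (D : List (Seqc I)) (X : Seqc I) : List (Seqc I) :=
  D.filter fun s => decide (OccursIn X s)

/-- conf(r) = |seq(r)| / |ant(r)|. -/
def conf (D : List (Seqc I)) (X Y : Seqc I) : ℝ :=
  ((seqL D X Y).length : ℝ) / ((antL D X).length : ℝ)

variable (q : I → Seqc I → ℝ) (iu : I → ℝ)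

/-- u(i, s) = q(i, s) · iu(i). -/
def itemUtil (j : I) (s : Seqc I) : ℝ := q j s * iu j

/-- u(r, s): the sum of u(i, s) over all items occurring in X or Y. -/
def ruleUtilIn (X Y s : Seqc I) : ℝ :=
  ∑ j ∈ itemsOf X ∪ itemsOf Y, itemUtil q iu j s

/-- u(r) = Σ_{s ∈ seq(r)} u(r, s). -/
def ruleUtil (D : List (Seqc I)) (X Y : Seqc I) : ℝ :=
  ((seqL D X Y).map (ruleUtilIn q iu X Y)).sum

/-- I-extension of a sequence: insert item i into the last itemset. -/
def iExt (X : Seqc I) (i : I) : Seqc I := X.dropLast ++ [insert i (X.getLastD ∅)]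

/-- S-extension of a sequence: append the singleton itemset {i}. -/
def sExt (X : Seqc I) (i : I) : Seqc I := X ++ [{i}]

/-- X' is obtained from the rule X → Y by a left I- or S-expansion with item i. -/
def IsLeftExp (X Y : Seqc I) (i : I) (X' : Seqc I) : Prop :=
  i ∉ itemsOf Y ∧
    ((X' = iExt X i ∧ ∀ a ∈ X.getLastD ∅, a < i) ∨ X' = sExt X i)

/-- Y' is obtained from the rule X → Y by a right I- or S-expansion with item i. -/
def IsRightExp (X Y : Seqc I) (i : I) (Y' : Seqc I) : Prop :=
  i ∉ itemsOf X ∧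
    ((Y' = iExt Y i ∧ ∀ a ∈ Y.getLastD ∅, a < i) ∨ Y' = sExt Y i)

/-- ULeft(r, s): sum of u(j, s) over items j of s such that some left
expansion of r with j occurs in s. -/
def ULeft (X Y s : Seqc I) : ℝ :=
  ∑ j ∈ (itemsOf s).filter
      (fun j => ∃ X', IsLeftExp X Y j X' ∧ RuleOccursIn X' Y s),
    itemUtil q iu j s

/-- LEPEU(r, s). -/
def LEPEUs (X Y s : Seqc I) : ℝ :=
  if 0 < ULeft q iu X Y s then ruleUtilIn q iu X Y s + ULeft q iu X Y s else 0

/-- LEPEU(r) = Σ_{s ∈ seq(r)} LEPEU(r, s). -/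
def LEPEU (D : List (Seqc I)) (X Y : Seqc I) : ℝ :=
  ((seqL D X Y).map (LEPEUs q iu X Y)).sum

/-- URight(r, s): sum of u(j, s) over items j of s such that some right
expansion of r with j occurs in s. -/
def URight (X Y s : Seqc I) : ℝ :=
  ∑ j ∈ (itemsOf s).filter
      (fun j => ∃ Y', IsRightExp X Y j Y' ∧ RuleOccursIn X Y' s),
    itemUtil q iu j s

/-- REPEU(r, s). -/
def REPEUs (X Y s : Seqc I) : ℝ :=
  if 0 < URight q iu X Y s then ruleUtilIn q iu X Y s + URight q iu X Y s else 0

/-- REPEU(r) = Σ_{s ∈ seq(r)} REPEU(r, s). -/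
def REPEU (D : List (Seqc I)) (X Y : Seqc I) : ℝ :=
  ((seqL D X Y).map (REPEUs q iu X Y)).sum

/-- j occurs strictly after i in s: in a strictly later itemset, or in the
same itemset and strictly greater in the item order. -/
def AfterIn (s : Seqc I) (i j : I) : Prop :=
  ∃ a b : Fin s.length, i ∈ s.get a ∧ j ∈ s.get b ∧ (a < b ∨ (a = b ∧ i < j))

/-- UILeft(r, i, s): u(i, s) plus the sum of u(j, s) over items j of s
occurring strictly after i such that some left expansion of r with j occurs in s. -/
def UILeft (X Y : Seqc I) (i : I) (s : Seqc I) : ℝ :=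
  itemUtil q iu i s +
    ∑ j ∈ (itemsOf s).filter
        (fun j => AfterIn s i j ∧ ∃ X', IsLeftExp X Y j X' ∧ RuleOccursIn X' Y s),
      itemUtil q iu j s

/-- LERSPEU(r') = Σ_{s ∈ seq(r')} (u(r, s) + UILeft(r, i, s)), where r' = X⋄i → Y. -/
def LERSPEU (D : List (Seqc I)) (X Y : Seqc I) (i : I) (X' : Seqc I) : ℝ :=
  ((seqL D X' Y).map fun s => ruleUtilIn q iu X Y s + UILeft q iu X Y i s).sum

/-- UIRight(r, i, s): u(i, s) plus the sum of u(j, s) over items j of s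
occurring strictly after i in s. -/
def UIRight (i : I) (s : Seqc I) : ℝ :=
  itemUtil q iu i s +
    ∑ j ∈ (itemsOf s).filter (fun j => AfterIn s i j), itemUtil q iu j s

/-- RERSPEU(r') = Σ_{s ∈ seq(r')} (u(r, s) + UIRight(r, i, s)), where r' = X → Y⋄i. -/
def RERSPEU (D : List (Seqc I)) (X Y : Seqc I) (i : I) (Y' : Seqc I) : ℝ :=
  ((seqL D X Y').map fun s => ruleUtilIn q iu X Y s + UIRight q iu i s).sum

/-- The total utility of all items occurring in a sequence. -/
def totalUtil (s : Seqc I) : ℝ := ∑ j ∈ itemsOf s, itemUtil q iu j s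

/-- SEU(i): sum, over the sequences of D in which item i occurs, of the
total utility of the sequence. -/
def SEUitem (D : List (Seqc I)) (i : I) : ℝ :=
  ((D.filter fun s => decide (i ∈ itemsOf s)).map (totalUtil q iu)).sum

/-- SEU(r): sum, over the sequences of D in which the rule r occurs, of the
total utility of the sequence. -/
def SEUrule (D : List (Seqc I)) (X Y : Seqc I) : ℝ :=
  ((seqL D X Y).map (totalUtil q iu)).sum

/-- One expansion step on rules (as pairs (antecedent, consequent)):
either a left I- or S-expansion or a right I- or S-expansion with some item. -/
def ExpStep (p p' : Seqc I × Seqc I) : Prop :=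
  (∃ i, IsLeftExp p.1 p.2 i p'.1 ∧ p'.2 = p.2) ∨
    (∃ i, IsRightExp p.1 p.2 i p'.2 ∧ p'.1 = p.1)

theorem mem_itemsOf {j : I} {s : Seqc I} : j ∈ itemsOf s ↔ ∃ e ∈ s, j ∈ e := by
  induction s with
  | nil => simp [itemsOf]
  | cons a l ih =>
    have h : itemsOf (a :: l) = a ∪ itemsOf l := rfl
    simp [h, ih]

theorem itemsOf_append (s t : Seqc I) : itemsOf (s ++ t) = itemsOf s ∪ itemsOf t := by
  ext j
  simp only [Finset.mem_union, mem_itemsOf, List.mem_append, or_and_right, exists_or]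

theorem itemsOf_singleton (e : Finset I) : itemsOf [e] = e := by
  simp [itemsOf]

theorem itemsOf_mono_of_sublist {s t : Seqc I} (h : s.Sublist t) : itemsOf s ⊆ itemsOf t := by
  intro j hj
  obtain ⟨e, he, hje⟩ := mem_itemsOf.1 hj
  exact mem_itemsOf.2 ⟨e, h.subset he, hje⟩

theorem occursIn_iff_sublistForall₂ {s t : Seqc I} :
    OccursIn s t ↔ List.SublistForall₂ (· ⊆ ·) s t := by
  rw [List.sublistForall₂_iff]
  exact exists_congr fun _ => and_comm

theorem OccursIn.trans {s t v : Seqc I} (h₁ : OccursIn s t) (h₂ : OccursIn t v) :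
    OccursIn s v := by
  rw [occursIn_iff_sublistForall₂] at *
  exact _root_.trans h₁ h₂

theorem OccursIn.itemsOf_subset {s t : Seqc I} (h : OccursIn s t) : itemsOf s ⊆ itemsOf t := by
  obtain ⟨v, hv, hsv⟩ := h
  refine Finset.Subset.trans ?_ (itemsOf_mono_of_sublist hv)
  clear hv
  induction hsv with
  | nil => exact Finset.Subset.refl _
  | cons h _ ih => exact Finset.union_subset_union h ih

theorem dropLast_append_getLastD {Y : Seqc I} (hY : Y ≠ []) :
    Y.dropLast ++ [Y.getLastD ∅] = Y := by
  rw [List.getLastD_eq_getLast?, List.getLast?_eq_some_getLast hY]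
  exact List.dropLast_append_getLast hY

theorem occursIn_iExt {Y : Seqc I} (hY : Y ≠ []) (i : I) : OccursIn Y (iExt Y i) := by
  refine ⟨iExt Y i, List.Sublist.refl _, ?_⟩
  conv_lhs => rw [← dropLast_append_getLastD hY]
  exact List.rel_append (List.forall₂_same.2 fun _ _ => Finset.Subset.refl _)
    (.cons (Finset.subset_insert _ _) .nil)

theorem occursIn_sExt (Y : Seqc I) (i : I) : OccursIn Y (sExt Y i) :=
  ⟨Y, List.sublist_append_left _ _, List.forall₂_same.2 fun _ _ => Finset.Subset.refl _⟩

theorem itemsOf_iExt {Y : Seqc I} (hY : Y ≠ []) (i : I) :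
    itemsOf (iExt Y i) = insert i (itemsOf Y) := by
  conv_rhs => rw [← dropLast_append_getLastD hY]
  simp only [iExt, itemsOf_append, itemsOf_singleton, Finset.union_insert]

theorem itemsOf_sExt (Y : Seqc I) (i : I) : itemsOf (sExt Y i) = insert i (itemsOf Y) := by
  rw [sExt, itemsOf_append, itemsOf_singleton, Finset.union_comm, Finset.insert_eq]

theorem IsRightExp.occursIn {X Y Y' : Seqc I} {i : I} (h : IsRightExp X Y i Y') (hY : Y ≠ []) :
    OccursIn Y Y' := by
  obtain ⟨-, ⟨rfl, -⟩ | rfl⟩ := h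
  exacts [occursIn_iExt hY i, occursIn_sExt Y i]

theorem IsRightExp.itemsOf_eq {X Y Y' : Seqc I} {i : I} (h : IsRightExp X Y i Y')
    (hY : Y ≠ []) : itemsOf Y' = insert i (itemsOf Y) := by
  obtain ⟨-, ⟨rfl, -⟩ | rfl⟩ := h
  exacts [itemsOf_iExt hY i, itemsOf_sExt Y i]

theorem RuleOccursIn.of_occursIn_right {X Y Y' s : Seqc I} (h : RuleOccursIn X Y' s)
    (hY : OccursIn Y Y') : RuleOccursIn X Y s := by
  obtain ⟨k, hk, hks, hXs, hYs⟩ := h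
  exact ⟨k, hk, hks, hXs, hY.trans hYs⟩

theorem RuleOccursIn.itemsOf_union_subset {X Y s : Seqc I} (h : RuleOccursIn X Y s) :
    itemsOf X ∪ itemsOf Y ⊆ itemsOf s := by
  obtain ⟨k, -, -, hXs, hYs⟩ := h
  exact Finset.union_subset
    (hXs.itemsOf_subset.trans (itemsOf_mono_of_sublist (List.take_sublist _ _)))
    (hYs.itemsOf_subset.trans (itemsOf_mono_of_sublist (List.drop_sublist _ _)))

theorem sum_map_filter_le_sum_map_filter {α : Type*} (l : List α) {p r : α → Prop} {f g : α → ℝ}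
    (hpr : ∀ a, p a → r a) (hfg : ∀ a, p a → f a ≤ g a) (hg : ∀ a, r a → 0 ≤ g a) :
    ((l.filter fun a => decide (p a)).map f).sum ≤
      ((l.filter fun a => decide (r a)).map g).sum := by
  induction l with
  | nil => simp
  | cons a l ih =>
    by_cases hp : p a
    · simpa [List.filter_cons, hp, hpr a hp] using add_le_add (hfg a hp) ih
    · by_cases hr : r a
      · simpa [List.filter_cons, hp, hr] using ih.trans (le_add_of_nonneg_left (hg a hr))
      · simpa [List.filter_cons, hp, hr] using ih

theorem REPEUs_nonneg {s : Seqc I} (hs : ∀ j ∈ itemsOf s, 0 < itemUtil q iu j s)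
    {X Y : Seqc I} (h : RuleOccursIn X Y s) : 0 ≤ REPEUs q iu X Y s := by
  unfold REPEUs
  split_ifs with hU
  · exact add_nonneg
      (Finset.sum_nonneg fun j hj => (hs j (h.itemsOf_union_subset hj)).le) hU.le
  · exact le_rfl

theorem itemUtil_le_URight {s : Seqc I} (hs : ∀ j ∈ itemsOf s, 0 < itemUtil q iu j s)
    {X Y Y' : Seqc I} {i : I} (hexp : IsRightExp X Y i Y') (h : RuleOccursIn X Y' s)
    (hi : i ∈ itemsOf s) : itemUtil q iu i s ≤ URight q iu X Y s :=
  Finset.single_le_sum (f := fun j => itemUtil q iu j s)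
    (fun j hj => (hs j (Finset.mem_filter.1 hj).1).le)
    (Finset.mem_filter.2 ⟨hi, Y', hexp, h⟩)

theorem ruleUtilIn_le_REPEUs {s : Seqc I} (hs : ∀ j ∈ itemsOf s, 0 < itemUtil q iu j s)
    {X Y Y' : Seqc I} (hY : Y ≠ []) {i : I} (hexp : IsRightExp X Y i Y')
    (h : RuleOccursIn X Y' s) : ruleUtilIn q iu X Y' s ≤ REPEUs q iu X Y s := by
  have hU : itemsOf X ∪ itemsOf Y' = insert i (itemsOf X ∪ itemsOf Y) := by
    rw [hexp.itemsOf_eq hY, Finset.union_insert]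
  have hi : i ∈ itemsOf s := h.itemsOf_union_subset (hU ▸ Finset.mem_insert_self _ _)
  have hle := itemUtil_le_URight q iu hs hexp h hi
  have hpos := hs i hi
  rw [REPEUs, if_pos (hpos.trans_le hle), ruleUtilIn, hU]
  by_cases hmem : i ∈ itemsOf X ∪ itemsOf Y
  · rw [Finset.insert_eq_of_mem hmem]
    exact le_add_of_nonneg_right (hpos.trans_le hle).le
  · rw [Finset.sum_insert hmem, add_comm]
    exact add_le_add le_rfl hle

/-- if r' is obtained from r = X → Y by a right I- or S-expansion
with item i, then u(r') ≤ REPEU(r). -/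
theorem utility_le_REPEU_of_rightExp
    (hiu : ∀ j : I, 0 < iu j)
    (hq : ∀ (j : I) (s : Seqc I), j ∈ itemsOf s → 0 < q j s)
    (D : List (Seqc I)) (hD : ∀ s ∈ D, WFSeq s)
    (X Y : Seqc I) (hX : WFSeq X) (hY : WFSeq Y)
    (hXY : Disjoint (itemsOf X) (itemsOf Y))
    (i : I) (Y' : Seqc I) (hexp : IsRightExp X Y i Y')
    (hY' : WFSeq Y') (hXY' : Disjoint (itemsOf X) (itemsOf Y')) :
    ruleUtil q iu D X Y' ≤ REPEU q iu D X Y := by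
  have hs : ∀ s : Seqc I, ∀ j ∈ itemsOf s, 0 < itemUtil q iu j s := fun s j hj =>
    mul_pos (hq j s hj) (hiu j)
  exact sum_map_filter_le_sum_map_filter D
    (fun _ h => h.of_occursIn_right (hexp.occursIn hY.1))
    (fun s h => ruleUtilIn_le_REPEUs q iu (hs s) hY.1 hexp h)
    (fun s h => REPEUs_nonneg q iu (hs s) h)

end TotalSR
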